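/- For every integer n ≥ 2, the maximum size A(n,2,2) of a 2-signature code of length n with constant weight 2 equals g(n;C₄), the maximum number of edges of a C₄-free simple graph on n vertices. -/

import Mathlib

open Finset

/-- A binary code of length `n`: every coordinate of every codeword is 0 or 1. -/
def IsBinaryCode {n : ℕ} (C : Finset (Fin n → ℝ)) : Prop :=
  ∀ c ∈ C, ∀ i, c i = 0 ∨ c i = 1

/-- `C` is a `t`-signature code. -/
def IsSignatureCode {n : ℕ} (t : ℕ) (C : Finset (Fin n → ℝ)) : Prop :=
  ∀ C₁ ⊆ C, ∀ C₂ ⊆ C, C₁ ≠ C₂ →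
    1 ≤ C₁.card → C₁.card ≤ t → 1 ≤ C₂.card → C₂.card ≤ t →
    ∀ lam mu : (Fin n → ℝ) → ℝ,
      (∀ c ∈ C₁, 0 < lam c) → (∀ c ∈ C₂, 0 < mu c) →
      (∑ c ∈ C₁, lam c) = 1 → (∑ c ∈ C₂, mu c) = 1 →
      (∑ c ∈ C₁, lam c • c) ≠ (∑ c ∈ C₂, mu c • c)

/-- A simple graph is `C₄`-free if it contains no cycle on four distinct vertices. -/
def C4Free {V : Type*} (G : SimpleGraph V) : Prop :=
  ¬ ∃ a b c d : V,
      a ≠ b ∧ a ≠ c ∧ a ≠ d ∧ b ≠ c ∧ b ≠ d ∧ c ≠ d ∧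
      G.Adj a b ∧ G.Adj b c ∧ G.Adj c d ∧ G.Adj d a

/-- `A(n,2,2)`: the maximum size of a 2-signature code of length `n` with constant weight 2. -/
noncomputable def Amax22 (n : ℕ) : ℕ :=
  sSup {M | ∃ C : Finset (Fin n → ℝ), IsBinaryCode C ∧
    (∀ c ∈ C, ({k | c k = 1} : Set (Fin n)).ncard = 2) ∧
    IsSignatureCode 2 C ∧ C.card = M}

/-- `g(n;C₄)`: the maximum number of edges of a `C₄`-free simple graph on `n` vertices. -/
noncomputable def gC4 (n : ℕ) : ℕ :=
  sSup {e | ∃ G : SimpleGraph (Fin n), C4Free G ∧ G.edgeSet.ncard = e}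


/-- The 0/1 indicator vector of the pair `{a, b}`. -/
def edgeVec {n : ℕ} (a b : Fin n) : Fin n → ℝ :=
  fun i => if i = a ∨ i = b then 1 else 0

lemma edgeVec_comm {n : ℕ} (a b : Fin n) : edgeVec a b = edgeVec b a := by
  funext i
  simp only [edgeVec, or_comm]

lemma edgeVec_inj {n : ℕ} {a b c d : Fin n} (hab : a ≠ b) (h : edgeVec a b = edgeVec c d) :
    (a = c ∧ b = d) ∨ (a = d ∧ b = c) := by
  have ha := congrFun h a
  have hb := congrFun h b
  simp only [edgeVec] at ha hb
  grind

lemma edgeVec_support {n : ℕ} (a b : Fin n) : {k | edgeVec a b k = 1} = ({a, b} : Set (Fin n)) := by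
  ext k
  simp only [edgeVec, Set.mem_ofPred_eq, Set.mem_insert_iff, Set.mem_singleton_iff]
  split_ifs with h <;> simp [h]

lemma eq_edgeVec_of_ncard_eq_two {n : ℕ} {c : Fin n → ℝ} (hc : ∀ i, c i = 0 ∨ c i = 1)
    (h : ({k | c k = 1} : Set (Fin n)).ncard = 2) : ∃ a b, a ≠ b ∧ c = edgeVec a b := by
  obtain ⟨a, b, hab, hs⟩ := Set.ncard_eq_two.mp h
  refine ⟨a, b, hab, funext fun i => ?_⟩
  have hi : c i = 1 ↔ i = a ∨ i = b := by simpa using Set.ext_iff.mp hs i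
  simp only [edgeVec]
  split_ifs with h'
  · exact hi.mpr h'
  · exact (hc i).resolve_right (mt hi.mp h')

/-- A convex combination of two edges of a `C₄`-free graph is not a convex combination of two
edges `ef` and `gh` such that `eg` is the first edge and crosses between them. -/
lemma C4Free.false_of_crossing {n : ℕ} {G : SimpleGraph (Fin n)} (hG : C4Free G)
    {c d e f g h : Fin n} {α β γ κ : ℝ} (hα : 0 < α) (hβ : 0 < β)
    (hαβ : α + β = 1) (hγκ : γ + κ = 1)
    (heg : G.Adj e g) (hcd : G.Adj c d) (hef : G.Adj e f) (hgh : G.Adj g h)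
    (heh : e ≠ h) (hgf : g ≠ f)
    (heq : α • edgeVec e g + β • edgeVec c d = γ • edgeVec e f + κ • edgeVec g h) : False := by
  have H (i : Fin n) := congrFun heq i
  simp only [edgeVec, Pi.add_apply, Pi.smul_apply, smul_eq_mul] at H
  have heg' := heg.ne
  have hef' := hef.ne
  have hgh' := hgh.ne
  have He : α + β * (if e = c ∨ e = d then 1 else 0) = γ := by simpa [heg', heh] using H e
  have Hg : α + β * (if g = c ∨ g = d then 1 else 0) = κ := by simpa [heg'.symm, hgf] using H g
  have he : ¬ (e = c ∨ e = d) := fun h' => by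
    rw [if_pos h'] at He
    split_ifs at Hg <;> linarith
  have hg : ¬ (g = c ∨ g = d) := fun h' => by
    rw [if_pos h'] at Hg
    split_ifs at He <;> linarith
  rw [if_neg he] at He
  rw [if_neg hg] at Hg
  have Hf : β * (if f = c ∨ f = d then 1 else 0) = γ + κ * (if f = h then 1 else 0) := by
    simpa [hef'.symm, hgf.symm] using H f
  have Hh : β * (if h = c ∨ h = d then 1 else 0) = γ * (if h = f then 1 else 0) + κ := by
    simpa [heh.symm, hgh'.symm] using H h
  have hfh : f ≠ h := fun h' => by
    rw [if_pos h'] at Hf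
    split_ifs at Hf
    all_goals linarith
  rw [if_neg hfh] at Hf
  rw [if_neg hfh.symm] at Hh
  have hf : f = c ∨ f = d := by
    by_contra h'
    rw [if_neg h'] at Hf
    linarith
  have hh : h = c ∨ h = d := by
    by_contra h'
    rw [if_neg h'] at Hh
    linarith
  have hadj : G.Adj f h := by
    rcases hf with rfl | rfl <;> rcases hh with rfl | rfl
    · exact absurd rfl hfh
    · exact hcd
    · exact hcd.symm
    · exact absurd rfl hfh
  exact hG ⟨e, f, h, g, hef', heh, heg', hfh, hgf.symm, hgh'.symm, hef, hadj, hgh.symm, heg.symm⟩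

/-- The set of edge vectors of `G`. -/
def edgeVecs {n : ℕ} (G : SimpleGraph (Fin n)) : Set (Fin n → ℝ) :=
  {x | ∃ a b, G.Adj a b ∧ x = edgeVec a b}

lemma C4Free.eq_or_eq {n : ℕ} {G : SimpleGraph (Fin n)} (hG : C4Free G)
    {x y z w : Fin n → ℝ} (hx : x ∈ edgeVecs G) (hy : y ∈ edgeVecs G) (hz : z ∈ edgeVecs G)
    (hw : w ∈ edgeVecs G) {α β γ κ : ℝ} (hα : 0 < α) (hβ : 0 < β)
    (hαβ : α + β = 1) (hγκ : γ + κ = 1)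
    (heq : α • x + β • y = γ • z + κ • w) : x = z ∨ x = w := by
  obtain ⟨a, b, hab, rfl⟩ := hx
  obtain ⟨c, d, hcd, rfl⟩ := hy
  obtain ⟨e, f, hef, rfl⟩ := hz
  obtain ⟨g, h, hgh, rfl⟩ := hw
  by_contra! hne
  obtain ⟨hne₁, hne₂⟩ := hne
  have hmem (i : Fin n) (hi : i = a ∨ i = b) : (i = e ∨ i = f) ∨ (i = g ∨ i = h) := by
    by_contra! h'
    have H := congrFun heq i
    simp only [edgeVec, Pi.add_apply, Pi.smul_apply, smul_eq_mul, if_pos hi, h'] at H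
    simp at H
    split_ifs at H <;> linarith
  -- The edge `ab` has one endpoint on `p` and the other on `r`, so it crosses `pq` and `rs`.
  have key (a b p q r s : Fin n) (hab : G.Adj a b) (hpq : G.Adj p q) (hrs : G.Adj r s)
      (γ κ : ℝ) (hγκ : γ + κ = 1)
      (heq : α • edgeVec a b + β • edgeVec c d = γ • edgeVec p q + κ • edgeVec r s)
      (h₁ : edgeVec a b ≠ edgeVec p q) (h₂ : edgeVec a b ≠ edgeVec r s)
      (ha : a = p) (hb : b = r) : False := by
    subst ha hb
    refine hG.false_of_crossing hα hβ hαβ hγκ hab hcd hpq hrs ?_ ?_ heq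
    · rintro rfl
      exact h₂ (edgeVec_comm _ _)
    · rintro rfl
      exact h₁ rfl
  have key' (a b p q r s : Fin n) (hab : G.Adj a b) (hpq : G.Adj p q) (hrs : G.Adj r s)
      (γ κ : ℝ) (hγκ : γ + κ = 1)
      (heq : α • edgeVec a b + β • edgeVec c d = γ • edgeVec p q + κ • edgeVec r s)
      (h₁ : edgeVec a b ≠ edgeVec p q) (h₂ : edgeVec a b ≠ edgeVec r s)
      (ha : a = p ∨ a = q) (hb : b = r ∨ b = s) : False := by
    rcases ha with ha | ha <;> rcases hb with hb | hb
    · exact key a b p q r s hab hpq hrs γ κ hγκ heq h₁ h₂ ha hb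
    · rw [edgeVec_comm r s] at heq h₂
      exact key a b p q s r hab hpq hrs.symm γ κ hγκ heq h₁ h₂ ha hb
    · rw [edgeVec_comm p q] at heq h₁
      exact key a b q p r s hab hpq.symm hrs γ κ hγκ heq h₁ h₂ ha hb
    · rw [edgeVec_comm r s] at heq h₂
      rw [edgeVec_comm p q] at heq h₁
      exact key a b q p s r hab hpq.symm hrs.symm γ κ hγκ heq h₁ h₂ ha hb
  have same (p q : Fin n) (h₁ : edgeVec a b ≠ edgeVec p q) (ha : a = p ∨ a = q)
      (hb : b = p ∨ b = q) : False := by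
    rcases ha with rfl | rfl <;> rcases hb with rfl | rfl
    · exact hab.ne rfl
    · exact h₁ rfl
    · exact h₁ (edgeVec_comm _ _)
    · exact hab.ne rfl
  rcases hmem a (.inl rfl) with ha | ha <;> rcases hmem b (.inr rfl) with hb | hb
  · exact same e f hne₁ ha hb
  · exact key' a b e f g h hab hef hgh γ κ hγκ heq hne₁ hne₂ ha hb
  · exact key' a b g h e f hab hgh hef κ γ (by linarith) (by rw [heq, add_comm]) hne₂ hne₁ ha hb
  · exact same g h hne₂ ha hb

lemma exists_pair_of_card_le_two {E : Type*} [AddCommGroup E] [Module ℝ E] [DecidableEq E]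
    {C : Finset E} (h₁ : 1 ≤ C.card) (h₂ : C.card ≤ 2)
    {lam : E → ℝ} (hpos : ∀ c ∈ C, 0 < lam c) (hsum : ∑ c ∈ C, lam c = 1) :
    ∃ x y, ∃ α β : ℝ, C = {x, y} ∧ 0 < α ∧ 0 < β ∧ α + β = 1 ∧
      ∑ c ∈ C, lam c • c = α • x + β • y := by
  obtain h | h : C.card = 1 ∨ C.card = 2 := by omega
  · obtain ⟨x, rfl⟩ := card_eq_one.mp h
    rw [sum_singleton] at hsum
    refine ⟨x, x, 1 / 2, 1 / 2, by simp, by norm_num, by norm_num, by norm_num, ?_⟩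
    rw [sum_singleton, hsum, ← add_smul]
    norm_num
  · obtain ⟨x, y, hxy, rfl⟩ := card_eq_two.mp h
    rw [sum_pair hxy] at hsum
    exact ⟨x, y, lam x, lam y, rfl, hpos x (by simp), hpos y (by simp), hsum, sum_pair hxy⟩

lemma C4Free.isSignatureCode {n : ℕ} {G : SimpleGraph (Fin n)} (hG : C4Free G)
    {C : Finset (Fin n → ℝ)} (hC : ∀ c ∈ C, c ∈ edgeVecs G) : IsSignatureCode 2 C := by
  classical
  intro C₁ hC₁ C₂ hC₂ hne h₁ h₁' h₂ h₂' lam mu hlam hmu hlam_sum hmu_sum heq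
  obtain ⟨x, y, α, β, rfl, hα, hβ, hαβ, hxy⟩ := exists_pair_of_card_le_two h₁ h₁' hlam hlam_sum
  obtain ⟨z, w, γ, κ, rfl, hγ, hκ, hγκ, hzw⟩ := exists_pair_of_card_le_two h₂ h₂' hmu hmu_sum
  have hx := hC x (hC₁ (by simp))
  have hy := hC y (hC₁ (by simp))
  have hz := hC z (hC₂ (by simp))
  have hw := hC w (hC₂ (by simp))
  rw [hxy, hzw] at heq
  have hx' := hG.eq_or_eq hx hy hz hw hα hβ hαβ hγκ heq
  have hy' := hG.eq_or_eq hy hx hz hw hβ hα (by linarith) hγκ (by rw [← heq, add_comm])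
  have hz' := hG.eq_or_eq hz hw hx hy hγ hκ hγκ hαβ heq.symm
  have hw' := hG.eq_or_eq hw hz hx hy hκ hγ (by linarith) hαβ (by rw [heq, add_comm])
  refine hne (Finset.Subset.antisymm ?_ ?_) <;> intro v <;> simp only [mem_insert, mem_singleton]
  · rintro (rfl | rfl) <;> assumption
  · rintro (rfl | rfl) <;> assumption

lemma IsSignatureCode.c4Free {n : ℕ} {G : SimpleGraph (Fin n)} {C : Finset (Fin n → ℝ)}
    (hS : IsSignatureCode 2 C) (hC : ∀ a b, G.Adj a b → edgeVec a b ∈ C) : C4Free G := by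
  classical
  rintro ⟨a, b, c, d, hab, hac, had, hbc, hbd, hcd, Aab, Abc, Acd, Ada⟩
  have h₁ : edgeVec a b ≠ edgeVec c d := fun h => by
    rcases edgeVec_inj hab h with h | h <;> simp_all
  have h₂ : edgeVec b c ≠ edgeVec d a := fun h => by
    rcases edgeVec_inj hbc h with h | h <;> simp_all
  have h₃ : edgeVec a b ∉ ({edgeVec b c, edgeVec d a} : Finset (Fin n → ℝ)) := by
    simp only [mem_insert, mem_singleton]
    rintro (h | h) <;> rcases edgeVec_inj hab h with h | h <;> simp_all
  refine hS {edgeVec a b, edgeVec c d} ?_ {edgeVec b c, edgeVec d a} ?_ ?_ ?_ ?_ ?_ ?_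
    (fun _ => 1 / 2) (fun _ => 1 / 2) (by simp) (by simp) ?_ ?_ ?_
  · simp [insert_subset_iff, hC _ _ Aab, hC _ _ Acd]
  · simp [insert_subset_iff, hC _ _ Abc, hC _ _ Ada]
  · exact fun h => h₃ (h ▸ by simp)
  · simp [card_pair h₁]
  · simp [card_pair h₁]
  · simp [card_pair h₂]
  · simp [card_pair h₂]
  · rw [sum_pair h₁]
    norm_num
  · rw [sum_pair h₂]
    norm_num
  · rw [sum_pair h₁, sum_pair h₂]
    funext i
    simp only [edgeVec, Pi.add_apply, Pi.smul_apply, smul_eq_mul]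
    grind

lemma edgeVecs_ncard {n : ℕ} (G : SimpleGraph (Fin n)) :
    (edgeVecs G).ncard = G.edgeSet.ncard := by
  let F : Sym2 (Fin n) → Fin n → ℝ := Sym2.lift ⟨edgeVec, edgeVec_comm⟩
  have himage : edgeVecs G = F '' G.edgeSet := by
    ext x
    constructor
    · rintro ⟨a, b, hab, rfl⟩
      exact ⟨s(a, b), hab, rfl⟩
    · rintro ⟨e, he, rfl⟩
      induction e using Sym2.ind with
      | _ a b => exact ⟨a, b, he, rfl⟩
  rw [himage]
  refine Set.InjOn.ncard_image fun e he e' _ h => ?_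
  induction e using Sym2.ind with
  | _ a b =>
    induction e' using Sym2.ind with
    | _ c d => exact Sym2.eq_iff.mpr (edgeVec_inj (G.ne_of_adj he) h)

lemma edgeVecs_finite {n : ℕ} (G : SimpleGraph (Fin n)) : (edgeVecs G).Finite :=
  (Set.finite_range fun p : Fin n × Fin n => edgeVec p.1 p.2).subset <| by
    rintro x ⟨a, b, -, rfl⟩
    exact ⟨(a, b), rfl⟩

/-- The graph whose edges are the supports of the weight-two codewords of `C`. -/
def codeGraph {n : ℕ} (C : Finset (Fin n → ℝ)) : SimpleGraph (Fin n) where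
  Adj a b := a ≠ b ∧ edgeVec a b ∈ C
  symm := ⟨fun a b h => ⟨h.1.symm, edgeVec_comm a b ▸ h.2⟩⟩
  loopless := ⟨fun _ h => h.1 rfl⟩

lemma edgeVecs_codeGraph {n : ℕ} {C : Finset (Fin n → ℝ)} (hb : IsBinaryCode C)
    (hw : ∀ c ∈ C, ({k | c k = 1} : Set (Fin n)).ncard = 2) : edgeVecs (codeGraph C) = C := by
  ext c
  constructor
  · rintro ⟨a, b, h, rfl⟩
    exact h.2
  · intro hc
    obtain ⟨a, b, hab, rfl⟩ := eq_edgeVec_of_ncard_eq_two (hb c hc) (hw c hc)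
    exact ⟨a, b, ⟨hab, hc⟩, rfl⟩

theorem stmt_10 (n : ℕ) (hn : 2 ≤ n) : Amax22 n = gC4 n := by
  unfold Amax22 gC4
  congr 1
  ext M
  constructor
  · rintro ⟨C, hb, hw, hS, rfl⟩
    refine ⟨codeGraph C, hS.c4Free fun _ _ h => h.2, ?_⟩
    rw [← edgeVecs_ncard, edgeVecs_codeGraph hb hw, Set.ncard_coe_finset]
  · rintro ⟨G, hG, rfl⟩
    refine ⟨(edgeVecs_finite G).toFinset, ?_, ?_, ?_, ?_⟩
    · intro c hc i
      obtain ⟨a, b, -, rfl⟩ := (edgeVecs_finite G).mem_toFinset.mp hc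
      simp only [edgeVec]
      split_ifs <;> simp
    · intro c hc
      obtain ⟨a, b, hab, rfl⟩ := (edgeVecs_finite G).mem_toFinset.mp hc
      rw [edgeVec_support, Set.ncard_pair hab.ne]
    · exact hG.isSignatureCode fun c hc => (edgeVecs_finite G).mem_toFinset.mp hc
    · rw [← Set.ncard_eq_toFinset_card _ (edgeVecs_finite G), edgeVecs_ncard]
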